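/- Let f : ℤ → ℝ be nonnegative with bounded variation and fix a system of peaks as in the context. Let 0 ≤ N ≤ 11, 0 ≤ K ≤ 299, and set L_N = 2^{N−6} if N ≥ 6 and L_N = 2^{N+6} if N ≤ 5. Let S be a finite set of pairs (n,k) with n ≥ 6, n ≡ N (mod 12), k ≡ K (mod 300), such that for each (n,k) ∈ S the class E^n_k is nonempty and satisfies alternative B. Then there exist an integer m ≥ 0 and integers x_1 < y_1 < u_1 < v_1 < x_2 < y_2 < u_2 < v_2 < … < u_m < v_m < x_{m+1} < y_{m+1} with y_i − x_i ≥ L_N for 1 ≤ i ≤ m+1, and u_i − y_i ≥ L_N, v_i − u_i ≥ L_N, x_{i+1} − v_i ≥ L_N for 1 ≤ i ≤ m, such that ∑_{i=1}^m ( A_{x_i,y_i}f + A_{x_{i+1},y_{i+1}}f − 2·A_{u_i,v_i}f ) ≥ (1/60)·∑_{(n,k)∈S} Var E^n_k. -/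

import Mathlib

open Finset

noncomputable section

/-- Average of `f : ℤ → ℝ` over the integer interval `[x, y]`:
`A_{x,y} f = (1/(y-x+1)) ∑_{k=x}^{y} f(k)`. -/
def avg (f : ℤ → ℝ) (x y : ℤ) : ℝ :=
  (∑ k ∈ Finset.Icc x y, f k) / ((y - x + 1 : ℤ) : ℝ)

/-- The discrete centered Hardy–Littlewood maximal function
`Mf(n) = sup_{r ≥ 0} (1/(2r+1)) ∑_{k=-r}^{r} |f(n+k)|`. -/
def dM (f : ℤ → ℝ) (n : ℤ) : ℝ :=
  ⨆ r : ℕ, avg (fun k => |f k|) (n - r) (n + r)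

/-- The total variation `Var f = ∑_{k ∈ ℤ} |f(k+1) - f(k)|`. -/
def dVar (f : ℤ → ℝ) : ℝ := ∑' k : ℤ, |f (k + 1) - f k|

/-- `f` has bounded variation. -/
def BddVar (f : ℤ → ℝ) : Prop := Summable fun k : ℤ => |f (k + 1) - f k|

/-- A peak for `f`: integers `p < r < q` with `Mf(p) < Mf(r)` and `Mf(q) < Mf(r)`. -/
def IsPeak (f : ℤ → ℝ) (p r q : ℤ) : Prop :=
  p < r ∧ r < q ∧ dM f p < dM f r ∧ dM f q < dM f r

/-- The variation of a peak `{p < r < q}`: `2·Mf(r) - Mf(p) - Mf(q)`. -/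
def peakVar (f : ℤ → ℝ) (p r q : ℤ) : ℝ := 2 * dM f r - dM f p - dM f q

/-- An essential peak: `max_{p<k<q} f(k) ≤ Mf(r) - (1/4)·Var{p,r,q}`. -/
def IsEssentialPeak (f : ℤ → ℝ) (p r q : ℤ) : Prop :=
  IsPeak f p r q ∧
    ∀ k : ℤ, p < k → k < q → f k ≤ dM f r - (1 / 4) * peakVar f p r q

/-- `w` is the radius `ω(r)` of an (essential) peak with center `r`:
the largest integer `w > 0` with `A_w f(r) = Mf(r)`. -/
def IsRadius (f : ℤ → ℝ) (r w : ℤ) : Prop :=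
  0 < w ∧ avg f (r - w) (r + w) = dM f r ∧
    ∀ w' : ℤ, 0 < w' → avg f (r - w') (r + w') = dM f r → w' ≤ w

open scoped Classical

/-- The class `E^n_k` of (indices of) essential peaks `𝕡_i = {a_i < b_i < a_{i+1}}`
of the fixed system with radius `2^{n-1} < ω(b_i) ≤ 2^n` and
`k·2^{n-5} < b_i ≤ (k+1)·2^{n-5}`. -/
def Enk (f : ℤ → ℝ) (a b : ℕ → ℤ) (σ n : ℕ) (k : ℤ) : Finset ℕ :=
  (Finset.Icc 1 σ).filter fun i =>
    IsEssentialPeak f (a i) (b i) (a (i + 1)) ∧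
    ∃ w : ℤ, IsRadius f (b i) w ∧ 2 ^ (n - 1) < w ∧ w ≤ 2 ^ n ∧
      k * 2 ^ (n - 5) < b i ∧ b i ≤ (k + 1) * 2 ^ (n - 5)

/-- `Var E^n_k`, the total variation of the peaks in the class `E^n_k`. -/
def varEnk (f : ℤ → ℝ) (a b : ℕ → ℤ) (σ n : ℕ) (k : ℤ) : ℝ :=
  ∑ i ∈ Enk f a b σ n k, peakVar f (a i) (b i) (a (i + 1))

/-- Alternative A of Lemma 5, for the class indexed by `(n,k)`, with `V = Var E^n_k`. -/
def AltA (f : ℤ → ℝ) (n : ℕ) (k : ℤ) (V : ℝ) : Prop :=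
  ∃ s α β γ δ t : ℤ, s < α ∧ α < β ∧ β < γ ∧ γ < δ ∧ δ < t ∧
    (k - 64) * 2 ^ (n - 5) ≤ s ∧ t ≤ (k + 65) * 2 ^ (n - 5) ∧
    2 ^ (n - 5) ≤ α - s ∧ 2 ^ (n - 5) ≤ β - α ∧ 2 ^ (n - 4) ≤ γ - β ∧
    2 ^ (n - 5) ≤ δ - γ ∧ 2 ^ (n - 5) ≤ t - δ ∧
    (1 / 24 : ℝ) * V ≤ min (f s) (f t) - max (avg f α β) (avg f γ δ)

/-- Alternative B of Lemma 5, for the class indexed by `(n,k)`, with `V = Var E^n_k`. -/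
def AltB (f : ℤ → ℝ) (n : ℕ) (k : ℤ) (V : ℝ) : Prop :=
  ∃ α β u v γ δ : ℤ, α < β ∧ β < u ∧ u < v ∧ v < γ ∧ γ < δ ∧
    (k - 64) * 2 ^ (n - 5) ≤ α ∧ δ ≤ (k + 65) * 2 ^ (n - 5) ∧
    2 ^ (n - 5) ≤ β - α ∧ 2 ^ (n - 5) ≤ u - β ∧ 2 ^ (n - 5) ≤ v - u ∧
    2 ^ (n - 5) ≤ γ - v ∧ 2 ^ (n - 5) ≤ δ - γ ∧
    (1 / 24 : ℝ) * V ≤ min (avg f α β) (avg f γ δ) - avg f u v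

/-! Chains: a head interval followed by pairs (low interval, high interval). -/

def chVal (f : ℤ → ℝ) : ℤ × ℤ → List ((ℤ × ℤ) × (ℤ × ℤ)) → ℝ
  | _, [] => 0
  | H, (l, h) :: r => avg f H.1 H.2 + avg f h.1 h.2 - 2 * avg f l.1 l.2 + chVal f h r

def ChVld (L : ℤ) : ℤ × ℤ → List ((ℤ × ℤ) × (ℤ × ℤ)) → Prop
  | H, [] => L ≤ H.2 - H.1
  | H, (l, h) :: r => L ≤ H.2 - H.1 ∧ L ≤ l.1 - H.2 ∧ L ≤ l.2 - l.1 ∧ L ≤ h.1 - l.2 ∧ ChVld L h r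

def ChMem (e : ℤ × ℤ) : ℤ × ℤ → List ((ℤ × ℤ) × (ℤ × ℤ)) → Prop
  | H, [] => e = H
  | H, (l, h) :: r => e = H ∨ e = l ∨ ChMem e h r

theorem chMem_head (H : ℤ × ℤ) (r) : ChMem H H r := by
  cases r with
  | nil => simp [ChMem]
  | cons p r => simp [ChMem]

theorem chVld_head {L : ℤ} {H : ℤ × ℤ} {r} (h : ChVld L H r) : L ≤ H.2 - H.1 := by
  cases r with
  | nil => simpa [ChVld] using h
  | cons p r => exact h.1

theorem chVld_replace {L : ℤ} {H H' : ℤ × ℤ} {r} (h : ChVld L H r) (h1 : L ≤ H'.2 - H'.1)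
    (h2 : H'.2 ≤ H.2) : ChVld L H' r := by
  cases r with
  | nil => simpa [ChVld] using h1
  | cons p r =>
    obtain ⟨a1, a2, a3, a4, a5⟩ := h
    exact ⟨h1, by omega, a3, a4, a5⟩

theorem chVal_replace {f : ℤ → ℝ} {H H' : ℤ × ℤ} {r} (h : avg f H.1 H.2 ≤ avg f H'.1 H'.2) :
    chVal f H r ≤ chVal f H' r := by
  cases r with
  | nil => simp [chVal]
  | cons p r =>
    simp only [chVal]; linarith

theorem chMem_replace {H H' : ℤ × ℤ} {r} {e} (h : ChMem e H' r) : e = H' ∨ ChMem e H r := by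
  cases r with
  | nil => left; simpa [ChMem] using h
  | cons p r =>
    rcases h with h | h | h
    · exact Or.inl h
    · exact Or.inr (Or.inr (Or.inl h))
    · exact Or.inr (Or.inr (Or.inr h))

theorem chMem_left {L : ℤ} (hL : 0 < L) : ∀ (r) (H : ℤ × ℤ), ChVld L H r → ∀ e, ChMem e H r →
    H.1 ≤ e.1 ∧ L ≤ e.2 - e.1
  | [], H, hv, e, he => by
    simp only [ChMem, ChVld] at he hv; subst he; exact ⟨le_refl _, hv⟩
  | (l, h) :: r, H, hv, e, he => by
    obtain ⟨a1, a2, a3, a4, a5⟩ := hv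
    rcases he with rfl | rfl | he
    · exact ⟨le_refl _, a1⟩
    · exact ⟨by omega, a3⟩
    · have := chMem_left hL r h a5 e he
      exact ⟨by omega, this.2⟩

/-- Inserting a high-low-high pattern to the right of the head. -/
theorem ins_right (f : ℤ → ℝ) (L : ℤ) (hL : 0 < L) (α β u v γ δ : ℤ) (d : ℝ)
    (h1 : L ≤ β - α) (h2 : L ≤ u - β) (h3 : L ≤ v - u) (h4 : L ≤ γ - v) (h5 : L ≤ δ - γ)
    (d1 : d ≤ avg f α β - avg f u v) (d2 : d ≤ avg f γ δ - avg f u v) :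
    ∀ (r) (H : ℤ × ℤ), ChVld L H r → (∀ e, ChMem e H r → δ + L ≤ e.1 ∨ e.2 + L ≤ α) →
      H.2 + L ≤ α → ∃ H' r', ChVld L H' r' ∧ H.1 ≤ H'.1 ∧ avg f H.1 H.2 ≤ avg f H'.1 H'.2 ∧
        chVal f H r + 2 * d ≤ chVal f H' r' ∧
        ∀ e, ChMem e H' r' → ChMem e H r ∨ (α ≤ e.1 ∧ e.2 ≤ δ)
  | [], H, hv, hs, hh => by
    simp only [ChVld] at hv
    by_cases hc : avg f α β ≤ avg f H.1 H.2
    · refine ⟨H, [((u, v), (γ, δ))], ?_, le_refl _, le_refl _, ?_, ?_⟩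
      · simp only [ChVld]; omega
      · simp only [chVal]; linarith
      · intro e he
        simp only [ChMem] at he ⊢
        rcases he with rfl | rfl | rfl
        · exact Or.inl rfl
        · right; constructor <;> simp only <;> omega
        · right; constructor <;> simp only <;> omega
    · refine ⟨(α, β), [((u, v), (γ, δ))], ?_, ?_, ?_, ?_, ?_⟩
      · simp only [ChVld]; omega
      · simp only; omega
      · simp only; linarith
      · simp only [chVal]; linarith
      · intro e he
        simp only [ChMem] at he ⊢
        right
        rcases he with rfl | rfl | rfl <;> constructor <;> simp only <;> omega
  | (l, h) :: r, H, hv, hs, hh => by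
    obtain ⟨a1, a2, a3, a4, a5⟩ := hv
    have hsl := hs l (Or.inr (Or.inl rfl))
    have hsh := hs h (Or.inr (Or.inr (chMem_head _ _)))
    rcases hsl with hsl | hsl
    · refine ⟨H, ((u, v), (γ, δ)) :: (l, h) :: r, ?_, le_refl _, le_refl _, ?_, ?_⟩
      · simp only [ChVld]
        refine ⟨a1, by omega, by omega, by omega, by omega, by omega, a3, a4, a5⟩
      · simp only [chVal]; linarith
      · intro e he
        simp only [ChMem] at he ⊢
        rcases he with rfl | rfl | rfl | rfl | he
        · exact Or.inl (Or.inl rfl)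
        · right; constructor <;> simp only <;> omega
        · right; constructor <;> simp only <;> omega
        · exact Or.inl (Or.inr (Or.inl rfl))
        · exact Or.inl (Or.inr (Or.inr he))
    rcases hsh with hsh | hsh
    · refine ⟨H, (l, (α, β)) :: ((u, v), h) :: r, ?_, le_refl _, le_refl _, ?_, ?_⟩
      · simp only [ChVld]
        refine ⟨a1, a2, a3, by omega, by omega, by omega, by omega, by omega, a5⟩
      · simp only [chVal]; linarith
      · intro e he
        simp only [ChMem] at he ⊢
        rcases he with rfl | rfl | rfl | rfl | he
        · exact Or.inl (Or.inl rfl)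
        · exact Or.inl (Or.inr (Or.inl rfl))
        · right; constructor <;> simp only <;> omega
        · right; constructor <;> simp only <;> omega
        · exact Or.inl (Or.inr (Or.inr he))
    · obtain ⟨h', r', b1, b2, b3, b4, b5⟩ :=
        ins_right f L hL α β u v γ δ d h1 h2 h3 h4 h5 d1 d2 r h a5
          (fun e he => hs e (Or.inr (Or.inr he))) hsh
      refine ⟨H, (l, h') :: r', ⟨a1, a2, a3, by omega, b1⟩, le_refl _, le_refl _, ?_, ?_⟩
      · simp only [chVal]; linarith
      · intro e he
        simp only [ChMem] at he ⊢
        rcases he with rfl | rfl | he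
        · exact Or.inl (Or.inl rfl)
        · exact Or.inl (Or.inr (Or.inl rfl))
        · rcases b5 e he with h | h
          · exact Or.inl (Or.inr (Or.inr h))
          · exact Or.inr h

theorem ins_any (f : ℤ → ℝ) (L : ℤ) (hL : 0 < L) (α β u v γ δ : ℤ) (d : ℝ)
    (h1 : L ≤ β - α) (h2 : L ≤ u - β) (h3 : L ≤ v - u) (h4 : L ≤ γ - v) (h5 : L ≤ δ - γ)
    (d1 : d ≤ avg f α β - avg f u v) (d2 : d ≤ avg f γ δ - avg f u v)
    (r) (H : ℤ × ℤ) (hv : ChVld L H r) (hs : ∀ e, ChMem e H r → δ + L ≤ e.1 ∨ e.2 + L ≤ α) :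
    ∃ H' r', ChVld L H' r' ∧ chVal f H r + 2 * d ≤ chVal f H' r' ∧
        ∀ e, ChMem e H' r' → ChMem e H r ∨ (α ≤ e.1 ∧ e.2 ≤ δ) := by
  rcases hs H (chMem_head _ _) with hh | hh
  · have hH := chVld_head hv
    by_cases hc : avg f γ δ ≤ avg f H.1 H.2
    · refine ⟨(α, β), ((u, v), H) :: r, ?_, ?_, ?_⟩
      · refine ⟨by simpa using h1, by simpa using h2, by simpa using h3, ?_, hv⟩
        simp only; omega
      · simp only [chVal]; linarith
      · intro e he
        simp only [ChMem] at he
        rcases he with rfl | rfl | he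
        · right; constructor <;> simp only <;> omega
        · right; constructor <;> simp only <;> omega
        · exact Or.inl he
    · refine ⟨(α, β), ((u, v), (γ, δ)) :: r, ?_, ?_, ?_⟩
      · refine ⟨by simpa using h1, by simpa using h2, by simpa using h3, by simpa using h4,
          chVld_replace hv (by simpa using h5) (by simp only; omega)⟩
      · have := chVal_replace (f := f) (H := H) (H' := (γ, δ)) (r := r) (by simp only; linarith)
        simp only [chVal]; linarith
      · intro e he
        simp only [ChMem] at he
        rcases he with rfl | rfl | he
        · right; constructor <;> simp only <;> omega
        · right; constructor <;> simp only <;> omega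
        · rcases chMem_replace (H := H) he with rfl | he
          · right; constructor <;> simp only <;> omega
          · exact Or.inl he
  · obtain ⟨H', r', b1, _, _, b4, b5⟩ :=
      ins_right f L hL α β u v γ δ d h1 h2 h3 h4 h5 d1 d2 r H hv hs hh
    exact ⟨H', r', b1, b4, b5⟩

/-- A family of separated patterns. -/
structure Fam (f : ℤ → ℝ) (L : ℤ) (J : Finset (ℕ × ℤ)) (α β u v γ δ : ℕ × ℤ → ℤ)
    (d : ℕ × ℤ → ℝ) : Prop where
  h1 : ∀ j ∈ J, L ≤ β j - α j
  h2 : ∀ j ∈ J, L ≤ u j - β j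
  h3 : ∀ j ∈ J, L ≤ v j - u j
  h4 : ∀ j ∈ J, L ≤ γ j - v j
  h5 : ∀ j ∈ J, L ≤ δ j - γ j
  d0 : ∀ j ∈ J, 0 ≤ d j
  d1 : ∀ j ∈ J, d j ≤ avg f (α j) (β j) - avg f (u j) (v j)
  d2 : ∀ j ∈ J, d j ≤ avg f (γ j) (δ j) - avg f (u j) (v j)
  wid : ∀ j ∈ J, δ j - α j ≤ 258 * L
  sep : ∀ j ∈ J, ∀ j' ∈ J, j ≠ j' → δ j + L ≤ α j' ∨ δ j' + L ≤ α j

theorem ins_all (f : ℤ → ℝ) (L : ℤ) (hL : 0 < L) (J : Finset (ℕ × ℤ))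
    (α β u v γ δ : ℕ × ℤ → ℤ) (d : ℕ × ℤ → ℝ) :
    Fam f L J α β u v γ δ d → ∀ (r) (H : ℤ × ℤ), ChVld L H r →
    (∀ j ∈ J, ∀ e, ChMem e H r → δ j + L ≤ e.1 ∨ e.2 + L ≤ α j) →
    ∃ H' r', ChVld L H' r' ∧ chVal f H r + 2 * ∑ j ∈ J, d j ≤ chVal f H' r' := by
  induction J using Finset.induction_on with
  | empty =>
    intro _ r H hv _
    exact ⟨H, r, hv, by simp⟩
  | insert j J hj ih =>
    intro hF r H hv hs
    have mj : j ∈ insert j J := Finset.mem_insert_self _ _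
    have mJ : ∀ i ∈ J, i ∈ insert j J := fun i hi => Finset.mem_insert_of_mem hi
    obtain ⟨H1, r1, b1, b2, b3⟩ := ins_any f L hL (α j) (β j) (u j) (v j) (γ j) (δ j) (d j)
      (hF.h1 j mj) (hF.h2 j mj) (hF.h3 j mj) (hF.h4 j mj) (hF.h5 j mj) (hF.d1 j mj) (hF.d2 j mj)
      r H hv (hs j mj)
    have hF' : Fam f L J α β u v γ δ d :=
      ⟨fun i hi => hF.h1 i (mJ i hi), fun i hi => hF.h2 i (mJ i hi), fun i hi => hF.h3 i (mJ i hi),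
       fun i hi => hF.h4 i (mJ i hi), fun i hi => hF.h5 i (mJ i hi), fun i hi => hF.d0 i (mJ i hi),
       fun i hi => hF.d1 i (mJ i hi), fun i hi => hF.d2 i (mJ i hi), fun i hi => hF.wid i (mJ i hi),
       fun i hi i' hi' => hF.sep i (mJ i hi) i' (mJ i' hi')⟩
    obtain ⟨H2, r2, c1, c2⟩ := ih hF' r1 H1 b1 (by
      intro i hi e he
      rcases b3 e he with h | ⟨h, h'⟩
      · exact hs i (mJ i hi) e h
      · have hne : i ≠ j := fun h => hj (h ▸ hi)
        rcases hF.sep i (mJ i hi) j mj hne with h'' | h''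
        · left; omega
        · right; omega)
    refine ⟨H2, r2, c1, ?_⟩
    rw [Finset.sum_insert hj]
    linarith

theorem avg_mul (g : ℤ → ℝ) (x y : ℤ) (h : x ≤ y) :
    avg g x y * ((y - x + 1 : ℤ) : ℝ) = ∑ k ∈ Finset.Icc x y, g k := by
  unfold avg
  have : ((y - x + 1 : ℤ) : ℝ) ≠ 0 := by
    have : (y - x + 1 : ℤ) ≠ 0 := by omega
    exact_mod_cast this
  field_simp

theorem sum_Icc_split (g : ℤ → ℝ) (x z y : ℤ) (h : x ≤ z) (h' : z < y) :
    ∑ k ∈ Finset.Icc x y, g k = ∑ k ∈ Finset.Icc x z, g k + ∑ k ∈ Finset.Icc (z + 1) y, g k := by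
  rw [← Finset.sum_union]
  · congr 1; ext k; simp only [Finset.mem_union, Finset.mem_Icc]; omega
  · rw [Finset.disjoint_left]; intro k; simp only [Finset.mem_Icc]; omega

/-- A long interval has a short subinterval with at least the same average. -/
theorem short_piece (g : ℤ → ℝ) (L : ℤ) (hL : 0 < L) : ∀ (n : ℕ) (x y : ℤ), L ≤ y - x →
    y - x ≤ n → ∃ x' y', x ≤ x' ∧ y' ≤ y ∧ L ≤ y' - x' ∧ y' - x' ≤ 2 * L ∧
      avg g x y ≤ avg g x' y' := by
  intro n
  induction n with
  | zero => intro x y h h'; exfalso; simp at h'; omega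
  | succ n ih =>
    intro x y h h'
    push_cast at h'
    by_cases hc : y - x ≤ 2 * L
    · exact ⟨x, y, le_refl _, le_refl _, h, hc, le_refl _⟩
    by_cases h1 : avg g x y ≤ avg g x (x + L)
    · exact ⟨x, x + L, le_refl _, by omega, by omega, by omega, h1⟩
    have h2 : avg g x y ≤ avg g (x + L + 1) y := by
      by_contra h2
      push Not at h1 h2
      have e1 := avg_mul g x y (by omega)
      have e2 := avg_mul g x (x + L) (by omega)
      have e3 := avg_mul g (x + L + 1) y (by omega)
      have e4 := sum_Icc_split g x (x + L) y (by omega) (by omega)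
      have p1 : (0 : ℝ) < ((x + L - x + 1 : ℤ) : ℝ) := by
        have : (0 : ℤ) < x + L - x + 1 := by omega
        exact_mod_cast this
      have p2 : (0 : ℝ) < ((y - (x + L + 1) + 1 : ℤ) : ℝ) := by
        have : (0 : ℤ) < y - (x + L + 1) + 1 := by omega
        exact_mod_cast this
      have q1 := mul_lt_mul_of_pos_right h1 p1
      have q2 := mul_lt_mul_of_pos_right h2 p2
      have q3 : ((y - x + 1 : ℤ) : ℝ) = ((x + L - x + 1 : ℤ) : ℝ) + ((y - (x + L + 1) + 1 : ℤ) : ℝ) := by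
        push_cast; ring
      rw [q3, mul_add] at e1
      linarith
    obtain ⟨x', y', a1, a2, a3, a4, a5⟩ := ih (x + L + 1) y (by omega) (by omega)
    exact ⟨x', y', by omega, a2, a3, a4, h2.trans a5⟩

/-- The window `[p, q]` is within distance `L` of the interval `e`. -/
def Tch (L p q : ℤ) (e : ℤ × ℤ) : Prop := e.1 < q + L ∧ p < e.2 + L

theorem avg_sub (f g : ℤ → ℝ) (x y : ℤ) : avg (fun k => f k - g k) x y = avg f x y - avg g x y := by
  unfold avg; rw [Finset.sum_sub_distrib, sub_div]

theorem avg_neg (f : ℤ → ℝ) (x y : ℤ) : avg (fun k => - f k) x y = - avg f x y := by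
  unfold avg; rw [Finset.sum_neg_distrib, neg_div]

theorem avg_sum (J : Finset (ℕ × ℤ)) (g : ℕ × ℤ → ℤ → ℝ) (x y : ℤ) :
    avg (fun k => ∑ j ∈ J, g j k) x y = ∑ j ∈ J, avg (g j) x y := by
  unfold avg; rw [Finset.sum_comm, Finset.sum_div]

theorem piece (g : ℤ → ℝ) (L : ℤ) (hL : 0 < L) (J : Finset (ℕ × ℤ)) (α δ : ℕ × ℤ → ℤ)
    (d : ℕ × ℤ → ℝ) (hd : ∀ j ∈ J, 0 ≤ d j) (hw : ∀ j ∈ J, δ j - α j ≤ 258 * L)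
    (e : ℤ × ℤ) (he : 4096 * L ≤ e.2 - e.1) :
    ∃ P : ℤ × ℤ, e.1 ≤ P.1 ∧ P.2 ≤ e.2 ∧ L ≤ P.2 - P.1 ∧
      avg g e.1 e.2 + ∑ j ∈ J, (if Tch L (α j) (δ j) P then d j else 0)
        - 6 / 10 * ∑ j ∈ J, (if Tch L (α j) (δ j) e then d j else 0) ≤ avg g P.1 P.2 := by
  set ψ : ℕ × ℤ → ℤ → ℝ := fun j k => if Tch L (α j) (δ j) e ∧ α j - 3 * L ≤ k ∧ k ≤ δ j + 3 * L
    then d j else 0 with hψ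
  obtain ⟨x', y', a1, a2, a3, a4, a5⟩ := short_piece (fun k => g k - ∑ j ∈ J, ψ j k) L hL
    (e.2 - e.1).toNat e.1 e.2 (by omega) (by omega)
  refine ⟨(x', y'), a1, a2, a3, ?_⟩
  rw [avg_sub, avg_sub, avg_sum, avg_sum] at a5
  have b1 : ∑ j ∈ J, (if Tch L (α j) (δ j) (x', y') then d j else 0) ≤
      ∑ j ∈ J, avg (ψ j) x' y' := by
    apply Finset.sum_le_sum
    intro j hj
    have hpos : (0 : ℝ) < ((y' - x' + 1 : ℤ) : ℝ) := by
      have : (0 : ℤ) < y' - x' + 1 := by omega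
      exact_mod_cast this
    unfold avg
    rw [le_div_iff₀ hpos]
    split_ifs with ht
    · have : ∀ k ∈ Finset.Icc x' y', ψ j k = d j := by
        intro k hk
        rw [Finset.mem_Icc] at hk
        simp only [Tch] at ht
        have hc : Tch L (α j) (δ j) e ∧ α j - 3 * L ≤ k ∧ k ≤ δ j + 3 * L := by
          unfold Tch; omega
        simp only [hψ]
        rw [if_pos hc]
      rw [Finset.sum_congr rfl this, Finset.sum_const, nsmul_eq_mul, mul_comm, Int.card_Icc]
      apply le_of_eq
      congr 1
      have : ((y' + 1 - x').toNat : ℤ) = y' - x' + 1 := by omega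
      exact_mod_cast this.symm
    · rw [zero_mul]
      apply Finset.sum_nonneg
      intro k _
      simp only [hψ]
      split_ifs
      · exact hd j hj
      · exact le_refl _
  have b2 : ∑ j ∈ J, avg (ψ j) e.1 e.2 ≤
      6 / 10 * ∑ j ∈ J, (if Tch L (α j) (δ j) e then d j else 0) := by
    rw [Finset.mul_sum]
    apply Finset.sum_le_sum
    intro j hj
    have hpos : (0 : ℝ) < ((e.2 - e.1 + 1 : ℤ) : ℝ) := by
      have : (0 : ℤ) < e.2 - e.1 + 1 := by omega
      exact_mod_cast this
    unfold avg
    rw [div_le_iff₀ hpos]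
    split_ifs with ht
    · have s1 : ∑ k ∈ Finset.Icc e.1 e.2, ψ j k ≤
          ∑ k ∈ Finset.Icc (α j - 3 * L) (δ j + 3 * L), d j := by
        simp only [hψ]
        rw [← Finset.sum_filter]
        apply Finset.sum_le_sum_of_subset_of_nonneg
        · intro k hk
          rw [Finset.mem_filter] at hk
          rw [Finset.mem_Icc]
          exact hk.2.2
        · intro _ _ _; exact hd j hj
      refine s1.trans ?_
      rw [Finset.sum_const, nsmul_eq_mul, Int.card_Icc]
      have hw' := hw j hj
      have t1 : (((δ j + 3 * L + 1 - (α j - 3 * L)).toNat : ℤ)) ≤ 265 * L := by omega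
      have t1' : (((δ j + 3 * L + 1 - (α j - 3 * L)).toNat : ℝ)) ≤ 265 * (L : ℝ) := by
        exact_mod_cast t1
      have t2 : 4096 * (L : ℝ) ≤ ((e.2 - e.1 + 1 : ℤ) : ℝ) := by
        have : 4096 * L ≤ e.2 - e.1 + 1 := by omega
        exact_mod_cast this
      have t3 : (0 : ℝ) < L := by exact_mod_cast hL
      have t4 : (((δ j + 3 * L + 1 - (α j - 3 * L)).toNat : ℝ)) ≤
          6 / 10 * ((e.2 - e.1 + 1 : ℤ) : ℝ) := by linarith
      have := mul_le_mul_of_nonneg_right t4 (hd j hj)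
      linarith
    · rw [mul_zero, zero_mul]
      apply le_of_eq
      apply Finset.sum_eq_zero
      intro k _
      simp only [hψ]
      rw [if_neg]
      exact fun h => ht h.1
  simp only
  linarith

/-- Weighted sum of the windows satisfying a predicate. -/
def wt (J : Finset (ℕ × ℤ)) (d : ℕ × ℤ → ℝ) (p : ℕ × ℤ → Prop) : ℝ :=
  ∑ j ∈ J, (if p j then d j else 0)

theorem wt_nonneg {J : Finset (ℕ × ℤ)} {d : ℕ × ℤ → ℝ} (hd : ∀ j ∈ J, 0 ≤ d j) (p) :
    0 ≤ wt J d p := by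
  apply Finset.sum_nonneg
  intro j hj
  split_ifs
  · exact hd j hj
  · exact le_refl _

theorem wt_mono {J : Finset (ℕ × ℤ)} {d : ℕ × ℤ → ℝ} (hd : ∀ j ∈ J, 0 ≤ d j) (p q : ℕ × ℤ → Prop)
    (h : ∀ j ∈ J, p j → q j) : wt J d p ≤ wt J d q := by
  apply Finset.sum_le_sum
  intro j hj
  have := hd j hj
  have := h j hj
  split_ifs <;> first | linarith | tauto

theorem wt_le3 {J : Finset (ℕ × ℤ)} {d : ℕ × ℤ → ℝ} (hd : ∀ j ∈ J, 0 ≤ d j)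
    (p q s t : ℕ × ℤ → Prop) (h : ∀ j ∈ J, t j → p j ∨ q j ∨ s j) :
    wt J d t ≤ wt J d p + wt J d q + wt J d s := by
  unfold wt
  rw [← Finset.sum_add_distrib, ← Finset.sum_add_distrib]
  apply Finset.sum_le_sum
  intro j hj
  have := hd j hj
  have := h j hj
  split_ifs <;> first | linarith | tauto

theorem wt_ge3 {J : Finset (ℕ × ℤ)} {d : ℕ × ℤ → ℝ} (hd : ∀ j ∈ J, 0 ≤ d j)
    (p q s t : ℕ × ℤ → Prop) (h : ∀ j ∈ J, p j ∨ q j ∨ s j → t j)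
    (h1 : ∀ j ∈ J, ¬ (p j ∧ q j)) (h2 : ∀ j ∈ J, ¬ (p j ∧ s j)) (h3 : ∀ j ∈ J, ¬ (q j ∧ s j)) :
    wt J d p + wt J d q + wt J d s ≤ wt J d t := by
  unfold wt
  rw [← Finset.sum_add_distrib, ← Finset.sum_add_distrib]
  apply Finset.sum_le_sum
  intro j hj
  have := hd j hj
  have := h j hj
  have := h1 j hj
  have := h2 j hj
  have := h3 j hj
  split_ifs <;> first | linarith | tauto

def TchC (L p q : ℤ) (H : ℤ × ℤ) (r : List ((ℤ × ℤ) × (ℤ × ℤ))) : Prop :=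
  ∃ e, ChMem e H r ∧ Tch L p q e

theorem shrink_step (L : ℤ) (hL : 0 < L) (J : Finset (ℕ × ℤ)) (α δ : ℕ × ℤ → ℤ)
    (d : ℕ × ℤ → ℝ) (hd : ∀ j ∈ J, 0 ≤ d j) (hw : ∀ j ∈ J, δ j - α j ≤ 258 * L)
    (H l h H' l' h' : ℤ × ℤ) (r r')
    (hv : ChVld (4096 * L) H ((l, h) :: r)) :
    2 * wt J d (fun j => TchC L (α j) (δ j) H' ((l', h') :: r'))
      - 16 / 10 * wt J d (fun j => TchC L (α j) (δ j) H ((l, h) :: r)) ≤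
    2 * (wt J d (fun j => Tch L (α j) (δ j) H') + wt J d (fun j => Tch L (α j) (δ j) l')
        + wt J d (fun j => TchC L (α j) (δ j) h' r'))
      - 16 / 10 * (wt J d (fun j => Tch L (α j) (δ j) H) + wt J d (fun j => Tch L (α j) (δ j) l)
        + wt J d (fun j => TchC L (α j) (δ j) h r)) := by
  have k1 := wt_le3 hd (fun j => Tch L (α j) (δ j) H') (fun j => Tch L (α j) (δ j) l')
    (fun j => TchC L (α j) (δ j) h' r') (fun j => TchC L (α j) (δ j) H' ((l', h') :: r')) (by
      rintro j hj ⟨e, he | he | he, ht⟩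
      · exact Or.inl (he ▸ ht)
      · exact Or.inr (Or.inl (he ▸ ht))
      · exact Or.inr (Or.inr ⟨e, he, ht⟩))
  obtain ⟨a1, a2, a3, a4, a5⟩ := hv
  have k2 := wt_ge3 hd (fun j => Tch L (α j) (δ j) H) (fun j => Tch L (α j) (δ j) l)
    (fun j => TchC L (α j) (δ j) h r) (fun j => TchC L (α j) (δ j) H ((l, h) :: r)) (by
      rintro j hj (ht | ht | ⟨e, he, ht⟩)
      · exact ⟨H, Or.inl rfl, ht⟩
      · exact ⟨l, Or.inr (Or.inl rfl), ht⟩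
      · exact ⟨e, Or.inr (Or.inr he), ht⟩) (by
      rintro j hj ⟨t1, t2⟩
      have := hw j hj
      simp only [Tch] at t1 t2
      omega) (by
      rintro j hj ⟨t1, e, he, t2⟩
      have := hw j hj
      have := chMem_left (by omega) r h a5 e he
      simp only [Tch] at t1 t2
      omega) (by
      rintro j hj ⟨t1, e, he, t2⟩
      have := hw j hj
      have := chMem_left (by omega) r h a5 e he
      simp only [Tch] at t1 t2
      omega)
  linarith

theorem shrink (f : ℤ → ℝ) (L : ℤ) (hL : 0 < L) (J : Finset (ℕ × ℤ)) (α δ : ℕ × ℤ → ℤ)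
    (d : ℕ × ℤ → ℝ) (hd : ∀ j ∈ J, 0 ≤ d j) (hw : ∀ j ∈ J, δ j - α j ≤ 258 * L) :
    ∀ (r) (H : ℤ × ℤ), ChVld (4096 * L) H r →
    ∃ H' r', ChVld L H' r' ∧ H.1 ≤ H'.1 ∧ H'.2 ≤ H.2 ∧
      chVal f H r + avg f H.1 H.2 + 2 * wt J d (fun j => TchC L (α j) (δ j) H' r')
        - 16 / 10 * wt J d (fun j => TchC L (α j) (δ j) H r) ≤ chVal f H' r' + avg f H'.1 H'.2 ∧
      (r ≠ [] → chVal f H r + 2 * wt J d (fun j => TchC L (α j) (δ j) H' r')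
        - 16 / 10 * wt J d (fun j => TchC L (α j) (δ j) H r) ≤ chVal f H' r')
  | [], H, hv => by
    obtain ⟨P, a1, a2, a3, a4⟩ := piece f L hL J α δ d hd hw H (chVld_head hv)
    refine ⟨P, [], a3, a1, a2, ?_, fun h => absurd rfl h⟩
    have e1 : ∀ H, wt J d (fun j => TchC L (α j) (δ j) H []) = wt J d (fun j => Tch L (α j) (δ j) H) := by
      intro H
      have : (fun j => TchC L (α j) (δ j) H []) = (fun j => Tch L (α j) (δ j) H) := by
        funext j; simp [TchC, ChMem]
      rw [this]
    have k := wt_mono hd (fun j => Tch L (α j) (δ j) P) (fun j => Tch L (α j) (δ j) H) (by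
      intro j hj; simp only [Tch]; omega)
    rw [e1, e1]
    change _ + wt J d (fun j => Tch L (α j) (δ j) P) - 6 / 10 * wt J d (fun j => Tch L (α j) (δ j) H) ≤ _ at a4
    simp only [chVal]
    linarith
  | (l, h) :: r, H, hv => by
    have hv' := hv
    obtain ⟨c1, c2, c3, c4, c5⟩ := hv
    obtain ⟨P, a1, a2, a3, a4⟩ := piece f L hL J α δ d hd hw H c1
    obtain ⟨Q, b1, b2, b3, b4⟩ := piece (fun k => - f k) L hL J α δ d hd hw l c3
    obtain ⟨h', r', e1, e2, e3, e4, -⟩ := shrink f L hL J α δ d hd hw r h c5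
    rw [avg_neg, avg_neg] at b4
    change _ + wt J d (fun j => Tch L (α j) (δ j) P) - 6 / 10 * wt J d (fun j => Tch L (α j) (δ j) H) ≤ _ at a4
    change _ + wt J d (fun j => Tch L (α j) (δ j) Q) - 6 / 10 * wt J d (fun j => Tch L (α j) (δ j) l) ≤ _ at b4
    have k := wt_mono hd (fun j => Tch L (α j) (δ j) P) (fun j => Tch L (α j) (δ j) H) (by
      intro j hj; simp only [Tch]; omega)
    have k0 := wt_nonneg hd (fun j => Tch L (α j) (δ j) H)
    have k1 := wt_nonneg hd (fun j => Tch L (α j) (δ j) l)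
    have ks := shrink_step L hL J α δ d hd hw H l h P Q h' r r' hv'
    refine ⟨P, (Q, h') :: r', ⟨a3, by omega, b3, by omega, e1⟩, a1, a2, ?_, fun _ => ?_⟩
    · simp only [chVal]; linarith
    · simp only [chVal]; linarith

theorem exists_far (J : Finset (ℕ × ℤ)) (α : ℕ × ℤ → ℤ) : ∃ z : ℤ, ∀ j ∈ J, z ≤ α j := by
  induction J using Finset.induction_on with
  | empty => exact ⟨0, by simp⟩
  | insert j J _ ih =>
    obtain ⟨z, hz⟩ := ih
    refine ⟨min z (α j), ?_⟩
    intro i hi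
    rcases Finset.mem_insert.1 hi with rfl | hi
    · exact min_le_right _ _
    · exact (min_le_left _ _).trans (hz i hi)

/-- One step of the construction: pass to a finer scale. -/
theorem batch (f : ℤ → ℝ) (L : ℤ) (hL : 0 < L) (J : Finset (ℕ × ℤ))
    (α β u v γ δ : ℕ × ℤ → ℤ) (d : ℕ × ℤ → ℝ) (hF : Fam f L J α β u v γ δ d)
    (r) (H : ℤ × ℤ) (hv : ChVld (4096 * L) H r) :
    ∃ H' r', ChVld L H' r' ∧ chVal f H r + 4 / 10 * ∑ j ∈ J, d j ≤ chVal f H' r' := by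
  have hsum : 0 ≤ ∑ j ∈ J, d j := Finset.sum_nonneg hF.d0
  by_cases hr : r = []
  · subst hr
    obtain ⟨z, hz⟩ := exists_far J α
    obtain ⟨H', r', b1, b2⟩ := ins_all f L hL J α β u v γ δ d hF [] (z - 2 * L, z - L)
      (by simp only [ChVld]; omega) (by
        intro j hj e he
        simp only [ChMem] at he
        subst he
        right
        have := hz j hj
        simp only; omega)
    refine ⟨H', r', b1, ?_⟩
    simp only [chVal] at b2 ⊢
    linarith
  · obtain ⟨H1, r1, a1, -, -, -, a5⟩ := shrink f L hL J α δ d hF.d0 hF.wid r H hv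
    have a5 := a5 hr
    set J' := J.filter (fun j => ¬ TchC L (α j) (δ j) H1 r1) with hJ'
    have hsub : ∀ j ∈ J', j ∈ J := fun j hj => (Finset.mem_filter.1 hj).1
    have hF' : Fam f L J' α β u v γ δ d :=
      ⟨fun i hi => hF.h1 i (hsub i hi), fun i hi => hF.h2 i (hsub i hi), fun i hi => hF.h3 i (hsub i hi),
       fun i hi => hF.h4 i (hsub i hi), fun i hi => hF.h5 i (hsub i hi), fun i hi => hF.d0 i (hsub i hi),
       fun i hi => hF.d1 i (hsub i hi), fun i hi => hF.d2 i (hsub i hi),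
       fun i hi => hF.wid i (hsub i hi),
       fun i hi i' hi' => hF.sep i (hsub i hi) i' (hsub i' hi')⟩
    obtain ⟨H', r', b1, b2⟩ := ins_all f L hL J' α β u v γ δ d hF' r1 H1 a1 (by
      intro j hj e he
      have := (Finset.mem_filter.1 hj).2
      by_contra hc
      apply this
      refine ⟨e, he, ?_⟩
      simp only [Tch]
      omega)
    refine ⟨H', r', b1, ?_⟩
    have s1 : wt J d (fun j => TchC L (α j) (δ j) H1 r1) + ∑ j ∈ J', d j = ∑ j ∈ J, d j := by
      rw [hJ', wt, ← Finset.sum_filter]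
      exact Finset.sum_filter_add_sum_filter_not _ _ _
    have s2 : wt J d (fun j => TchC L (α j) (δ j) H r) ≤ ∑ j ∈ J, d j := by
      apply Finset.sum_le_sum
      intro j hj
      have := hF.d0 j hj
      split_ifs <;> linarith
    linarith

/-- Converting a chain into sequences. -/
theorem chain_to_seq (f : ℤ → ℝ) (L : ℤ) : ∀ (r) (H : ℤ × ℤ), ChVld L H r →
    ∃ (m : ℕ) (X Y U V : ℕ → ℤ), X 0 = H.1 ∧ Y 0 = H.2 ∧ (∀ i ≤ m, L ≤ Y i - X i) ∧
      (∀ i < m, L ≤ U i - Y i ∧ L ≤ V i - U i ∧ L ≤ X (i + 1) - V i) ∧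
      ∑ i ∈ Finset.range m, (avg f (X i) (Y i) + avg f (X (i + 1)) (Y (i + 1))
        - 2 * avg f (U i) (V i)) = chVal f H r
  | [], H, hv => by
    refine ⟨0, fun _ => H.1, fun _ => H.2, fun _ => 0, fun _ => 0, rfl, rfl, ?_, ?_, ?_⟩
    · intro i _; exact hv
    · intro i hi; omega
    · simp [chVal]
  | (l, h) :: r, H, hv => by
    obtain ⟨a1, a2, a3, a4, a5⟩ := hv
    obtain ⟨m, X, Y, U, V, x0, y0, b1, b2, b3⟩ := chain_to_seq f L r h a5
    refine ⟨m + 1, fun i => Nat.casesOn i H.1 X, fun i => Nat.casesOn i H.2 Y,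
      fun i => Nat.casesOn i l.1 U, fun i => Nat.casesOn i l.2 V, rfl, rfl, ?_, ?_, ?_⟩
    · intro i hi
      cases i with
      | zero => exact a1
      | succ i => exact b1 i (by omega)
    · intro i hi
      cases i with
      | zero => exact ⟨a2, a3, by simpa [x0] using a4⟩
      | succ i => exact b2 i (by omega)
    · rw [Finset.sum_range_succ']
      simp only [chVal, x0, y0]
      rw [← b3]
      generalize ∑ i ∈ Finset.range m, (avg f (X i) (Y i) + avg f (X (i + 1)) (Y (i + 1))
        - 2 * avg f (U i) (V i)) = Z
      change Z + (avg f H.1 H.2 + avg f h.1 h.2 - 2 * avg f l.1 l.2) = _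
      ring

/-- The construction through all scales. -/
theorem all_scales (f : ℤ → ℝ) (n0 K : ℕ) (hn0 : 6 ≤ n0) (S : Finset (ℕ × ℤ))
    (V : ℕ × ℤ → ℝ) (hV : ∀ c ∈ S, 0 ≤ V c)
    (hS : ∀ c ∈ S, n0 ≤ c.1 ∧ c.1 % 12 = n0 % 12 ∧ c.2 % 300 = (K : ℤ) ∧ AltB f c.1 c.2 (V c)) :
    ∀ (t i : ℕ), (∀ c ∈ S, c.1 < n0 + 12 * (i + t)) → ∃ H r, ChVld (2 ^ (n0 + 12 * i - 6)) H r ∧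
      (1 / 60 : ℝ) * ∑ c ∈ S.filter (fun c => n0 + 12 * i ≤ c.1), V c ≤ chVal f H r := by
  intro t
  induction t with
  | zero =>
    intro i hi
    refine ⟨(0, 2 ^ (n0 + 12 * i - 6)), [], by simp [ChVld], ?_⟩
    rw [Finset.filter_eq_empty_iff.2]
    · simp [chVal]
    · intro c hc
      have := hi c hc
      omega
  | succ t ih =>
    intro i hi
    obtain ⟨H, r, hv, hval⟩ := ih (i + 1) (fun c hc => by have := hi c hc; omega)
    set L : ℤ := 2 ^ (n0 + 12 * i - 6) with hLdef
    have hL : 0 < L := by positivity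
    have e1 : (2 : ℤ) ^ (n0 + 12 * (i + 1) - 6) = 4096 * L := by
      rw [hLdef, show n0 + 12 * (i + 1) - 6 = (n0 + 12 * i - 6) + 12 by omega, pow_add]
      norm_num; ring
    have e2 : (2 : ℤ) ^ (n0 + 12 * i - 5) = 2 * L := by
      rw [hLdef, show n0 + 12 * i - 5 = (n0 + 12 * i - 6) + 1 by omega, pow_succ]
      ring
    rw [e1] at hv
    set J := S.filter (fun c => c.1 = n0 + 12 * i) with hJ
    have hB : ∀ c : ℕ × ℤ, ∃ w : ℤ × ℤ × ℤ × ℤ × ℤ × ℤ, c ∈ J →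
        ((c.2 - 64) * (2 * L) ≤ w.1 ∧ w.2.2.2.2.2 ≤ (c.2 + 65) * (2 * L) ∧
        2 * L ≤ w.2.1 - w.1 ∧ 2 * L ≤ w.2.2.1 - w.2.1 ∧ 2 * L ≤ w.2.2.2.1 - w.2.2.1 ∧
        2 * L ≤ w.2.2.2.2.1 - w.2.2.2.1 ∧ 2 * L ≤ w.2.2.2.2.2 - w.2.2.2.2.1 ∧
        (1 / 24 : ℝ) * V c ≤ min (avg f w.1 w.2.1) (avg f w.2.2.2.2.1 w.2.2.2.2.2)
          - avg f w.2.2.1 w.2.2.2.1) := by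
      intro c
      by_cases hc : c ∈ J
      · obtain ⟨hc1, hc2⟩ := Finset.mem_filter.1 hc
        obtain ⟨-, -, -, α, β, u, v, γ, δ, -, -, -, -, -, g1, g2, g3, g4, g5, g6, g7, g8⟩ := hS c hc1
        rw [hc2, e2] at g1 g2 g3 g4 g5 g6 g7
        exact ⟨(α, β, u, v, γ, δ), fun _ => ⟨g1, g2, g3, g4, g5, g6, g7, g8⟩⟩
      · exact ⟨(0, 0, 0, 0, 0, 0), fun h => absurd h hc⟩
    choose w hw using hB
    have hF : Fam f L J (fun j => (w j).1) (fun j => (w j).2.1) (fun j => (w j).2.2.1)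
        (fun j => (w j).2.2.2.1) (fun j => (w j).2.2.2.2.1) (fun j => (w j).2.2.2.2.2)
        (fun j => 1 / 24 * V j) := by
      refine ⟨?_, ?_, ?_, ?_, ?_, ?_, ?_, ?_, ?_, ?_⟩
      · intro j hj; have := hw j hj; omega
      · intro j hj; have := hw j hj; omega
      · intro j hj; have := hw j hj; omega
      · intro j hj; have := hw j hj; omega
      · intro j hj; have := hw j hj; omega
      · intro j hj
        have := hV j (Finset.mem_filter.1 hj).1
        linarith
      · intro j hj
        obtain ⟨-, -, -, -, -, -, -, g8⟩ := hw j hj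
        have := min_le_left (avg f (w j).1 (w j).2.1) (avg f (w j).2.2.2.2.1 (w j).2.2.2.2.2)
        linarith
      · intro j hj
        obtain ⟨-, -, -, -, -, -, -, g8⟩ := hw j hj
        have := min_le_right (avg f (w j).1 (w j).2.1) (avg f (w j).2.2.2.2.1 (w j).2.2.2.2.2)
        linarith
      · intro j hj
        obtain ⟨g1, g2, -⟩ := hw j hj
        linarith
      · intro j hj j' hj' hne
        obtain ⟨g1, g2, -⟩ := hw j hj
        obtain ⟨g1', g2', -⟩ := hw j' hj'
        obtain ⟨p1, p2⟩ := Finset.mem_filter.1 hj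
        obtain ⟨p1', p2'⟩ := Finset.mem_filter.1 hj'
        obtain ⟨-, -, q, -⟩ := hS j p1
        obtain ⟨-, -, q', -⟩ := hS j' p1'
        have hne2 : j.2 ≠ j'.2 := fun h => hne (Prod.ext (p2.trans p2'.symm) h)
        rcases lt_or_gt_of_ne hne2 with h | h
        · left
          have : j.2 + 300 ≤ j'.2 := by omega
          nlinarith
        · right
          have : j'.2 + 300 ≤ j.2 := by omega
          nlinarith
    obtain ⟨H', r', b1, b2⟩ := batch f L hL J _ _ _ _ _ _ _ hF r H hv
    refine ⟨H', r', b1, ?_⟩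
    have hsplit : S.filter (fun c => n0 + 12 * i ≤ c.1) =
        J ∪ S.filter (fun c => n0 + 12 * (i + 1) ≤ c.1) := by
      ext c
      simp only [hJ, Finset.mem_union, Finset.mem_filter]
      constructor
      · rintro ⟨h1, h2⟩
        have := (hS c h1).2.1
        by_cases h : c.1 = n0 + 12 * i
        · exact Or.inl ⟨h1, h⟩
        · exact Or.inr ⟨h1, by omega⟩
      · rintro (⟨h1, h2⟩ | ⟨h1, h2⟩)
        · exact ⟨h1, by omega⟩
        · exact ⟨h1, by omega⟩
    rw [hsplit, Finset.sum_union]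
    · rw [← Finset.mul_sum] at b2
      linarith
    · rw [Finset.disjoint_left]
      intro c h1 h2
      have := (Finset.mem_filter.1 h1).2
      have := (Finset.mem_filter.1 h2).2
      omega

/-- Proposition 2 of the paper (classes satisfying alternative B). -/
theorem stmt12 (f : ℤ → ℝ) (hf : ∀ n, 0 ≤ f n) (hbv : BddVar f)
    (σ : ℕ) (a b : ℕ → ℤ)
    (hab : ∀ i ∈ Finset.Icc 1 σ, a i < b i ∧ b i < a (i + 1))
    (hM : ∀ i ∈ Finset.Icc 1 σ,
      dM f (a i) < dM f (b i) ∧ dM f (a (i + 1)) < dM f (b i))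
    (N K : ℕ) (hN : N ≤ 11) (hK : K ≤ 299)
    (LN : ℤ) (hLN : LN = if 6 ≤ N then 2 ^ (N - 6) else 2 ^ (N + 6))
    (S : Finset (ℕ × ℤ))
    (hS : ∀ c ∈ S, 6 ≤ c.1 ∧ c.1 % 12 = N ∧ c.2 % 300 = (K : ℤ) ∧
      (Enk f a b σ c.1 c.2).Nonempty ∧ AltB f c.1 c.2 (varEnk f a b σ c.1 c.2)) :
    ∃ (m : ℕ) (x y u v : ℕ → ℤ),
      (∀ i ∈ Finset.Icc 1 (m + 1), x i < y i ∧ LN ≤ y i - x i) ∧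
      (∀ i ∈ Finset.Icc 1 m, y i < u i ∧ u i < v i ∧ v i < x (i + 1)) ∧
      (∀ i ∈ Finset.Icc 1 m,
        LN ≤ u i - y i ∧ LN ≤ v i - u i ∧ LN ≤ x (i + 1) - v i) ∧
      ∑ i ∈ Finset.Icc 1 m,
          (avg f (x i) (y i) + avg f (x (i + 1)) (y (i + 1)) - 2 * avg f (u i) (v i)) ≥
        (1 / 60 : ℝ) * ∑ c ∈ S, varEnk f a b σ c.1 c.2 := by
  obtain ⟨n0, hn6, hnN, hLn, hmin⟩ : ∃ n0 : ℕ, 6 ≤ n0 ∧ n0 % 12 = N ∧ LN = 2 ^ (n0 - 6) ∧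
      ∀ c : ℕ, 6 ≤ c → c % 12 = N → n0 ≤ c := by
    by_cases h : 6 ≤ N
    · exact ⟨N, h, by omega, by rw [hLN, if_pos h], fun c _ _ => by omega⟩
    · refine ⟨N + 12, by omega, by omega, ?_, fun c _ _ => by omega⟩
      rw [hLN, if_neg h]
      rfl
  have hV : ∀ c ∈ S, 0 ≤ varEnk f a b σ c.1 c.2 := by
    intro c _
    apply Finset.sum_nonneg
    intro i hi
    have := hM i (Finset.mem_filter.1 hi).1
    unfold peakVar
    linarith [this.1, this.2]
  obtain ⟨T, hT⟩ : ∃ T : ℕ, ∀ c ∈ S, c.1 < n0 + 12 * (0 + T) := by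
    refine ⟨S.sup (fun c => c.1) + 1, fun c hc => ?_⟩
    have : c.1 ≤ S.sup (fun c => c.1) := Finset.le_sup (f := fun c : ℕ × ℤ => c.1) hc
    omega
  obtain ⟨H, r, hv, hval⟩ := all_scales f n0 K hn6 S (fun c => varEnk f a b σ c.1 c.2) hV
    (fun c hc => by
      obtain ⟨h1, h2, h3, _, h5⟩ := hS c hc
      exact ⟨hmin c.1 h1 h2, by omega, h3, h5⟩) T 0 hT
  have hfil : S.filter (fun c => n0 + 12 * 0 ≤ c.1) = S := by
    apply Finset.filter_true_of_mem
    intro c hc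
    obtain ⟨h1, h2, _⟩ := hS c hc
    have := hmin c.1 h1 h2
    omega
  rw [hfil] at hval
  rw [show n0 + 12 * 0 - 6 = n0 - 6 by omega, ← hLn] at hv
  have hLpos : 0 < LN := by rw [hLn]; positivity
  obtain ⟨m, X, Y, U, V, -, -, b1, b2, b3⟩ := chain_to_seq f LN r H hv
  have hi1 : ∀ i ∈ Finset.Icc 1 m, i - 1 < m ∧ i - 1 + 1 = i := by
    intro i hi
    rw [Finset.mem_Icc] at hi
    omega
  refine ⟨m, fun i => X (i - 1), fun i => Y (i - 1), fun i => U (i - 1), fun i => V (i - 1),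
    ?_, ?_, ?_, ?_⟩
  · intro i hi
    rw [Finset.mem_Icc] at hi
    have := b1 (i - 1) (by omega)
    exact ⟨by simp only; omega, this⟩
  · intro i hi
    obtain ⟨h1, h2⟩ := hi1 i hi
    have := b2 (i - 1) h1
    rw [h2] at this
    simp only [Nat.add_sub_cancel]
    omega
  · intro i hi
    obtain ⟨h1, h2⟩ := hi1 i hi
    have := b2 (i - 1) h1
    rw [h2] at this
    simpa only [Nat.add_sub_cancel] using this
  · rw [ge_iff_le]
    refine hval.trans (le_of_eq ?_)
    rw [← b3]
    refine Finset.sum_bij (fun i _ => i + 1) ?_ ?_ ?_ ?_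
    · intro i hi
      rw [Finset.mem_range] at hi
      rw [Finset.mem_Icc]
      omega
    · intro i _ j _ hij
      simpa using hij
    · intro i hi
      exact ⟨i - 1, Finset.mem_range.2 (hi1 i hi).1, (hi1 i hi).2⟩
    · intro i _
      simp

end
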